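/- Fix a line ℓ of PG(2,q) and a point P ∈ ℓ, and let α be the bijection 𝓑 ↦ 𝓑 \ {P} from X_{P,ℓ} (the minimal blocking sets of PG(2,q) with the r∞-property with respect to P whose unique tangent through P is ℓ) onto Y_{Π_P} (the minimal affine blocking sets of AG(2,q) = PG(2,q) \ ℓ with the Π-property with respect to Π_P). Let Z_{P,ℓ} ⊆ X_{P,ℓ} be the set of all blocking semiovals of PG(2,q) containing P whose unique tangent through P is ℓ, and let W_{P,ℓ} be the set of all minimal affine blocking sets of AG(2,q) having the Π-strong property with respect to the direction Π_P. Then α(Z_{P,ℓ}) = W_{P,ℓ}. -/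

import Mathlib

abbrev Pt (F : Type) [Field F] : Type :=
  {P : Submodule F (Fin 3 → F) // Module.finrank F ↥P = 1}

abbrev Ln (F : Type) [Field F] : Type :=
  {L : Submodule F (Fin 3 → F) // Module.finrank F ↥L = 2}

variable {F : Type} [Field F]

def Incid (P : Pt F) (L : Ln F) : Prop := P.1 ≤ L.1

def IsTangent (K : Set (Pt F)) (L : Ln F) : Prop := ∃! P : Pt F, P ∈ K ∧ Incid P L

def IsSecant (K : Set (Pt F)) (L : Ln F) : Prop :=
  ∃ P Q : Pt F, P ≠ Q ∧ P ∈ K ∧ Q ∈ K ∧ Incid P L ∧ Incid Q L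

def IsBlocking (B : Set (Pt F)) : Prop :=
  (∀ L : Ln F, ∃ P ∈ B, Incid P L) ∧ (∀ L : Ln F, ∃ P : Pt F, Incid P L ∧ P ∉ B)

def IsMinimalBlocking (B : Set (Pt F)) : Prop :=
  IsBlocking B ∧ ∀ B' : Set (Pt F), B' ⊂ B → ¬ IsBlocking B'

def IsSemioval (K : Set (Pt F)) : Prop :=
  ∀ P ∈ K, ∃! L : Ln F, Incid P L ∧ IsTangent K L

def HasRInftyAt (B : Set (Pt F)) (P : Pt F) : Prop :=
  ∃ r : Ln F, Incid P r ∧ IsTangent B r ∧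
    ∀ L : Ln F, Incid P L → L ≠ r → IsSecant B L

def NonConcurrent (a b c : Ln F) : Prop :=
  ¬ ∃ P : Pt F, Incid P a ∧ Incid P b ∧ Incid P c

def VertexlessTriangle (a b c : Ln F) : Set (Pt F) :=
  {P | (Incid P a ∧ ¬ Incid P b ∧ ¬ Incid P c) ∨
       (¬ Incid P a ∧ Incid P b ∧ ¬ Incid P c) ∨
       (¬ Incid P a ∧ ¬ Incid P b ∧ Incid P c)}

def AffPts (l m : Ln F) : Set (Pt F) := {P | Incid P m ∧ ¬ Incid P l}

def IsAffBlocking (l : Ln F) (B : Set (Pt F)) : Prop :=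
  (∀ P ∈ B, ¬ Incid P l) ∧ (∀ m : Ln F, m ≠ l → ∃ P ∈ B, Incid P m)

def IsMinimalAffBlocking (l : Ln F) (B : Set (Pt F)) : Prop :=
  IsAffBlocking l B ∧ ∀ B' : Set (Pt F), B' ⊂ B → ¬ IsAffBlocking l B'

def PiProp (l : Ln F) (Pinf : Pt F) (B : Set (Pt F)) : Prop :=
  (∀ Q ∈ B, ∃ m : Ln F, m ≠ l ∧ ¬ Incid Pinf m ∧ Incid Q m ∧ IsTangent B m) ∧
  (∀ m : Ln F, m ≠ l → Incid Pinf m → ¬ (AffPts l m ⊆ B))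

def PiStrong (l : Ln F) (Pinf : Pt F) (B : Set (Pt F)) : Prop :=
  (∀ Q ∈ B, ∃! m : Ln F, m ≠ l ∧ ¬ Incid Pinf m ∧ Incid Q m ∧ IsTangent B m) ∧
  (∀ m : Ln F, m ≠ l → Incid Pinf m → ¬ (AffPts l m ⊆ B))


theorem pt_eq_of_le {P Q : Pt F} (h : P.1 ≤ Q.1) : P = Q :=
  Subtype.ext (Submodule.eq_of_le_of_finrank_eq h (P.2.trans Q.2.symm))

theorem ln_unique {P Q : Pt F} {l m : Ln F} (hPQ : P ≠ Q) (h1 : Incid P l) (h2 : Incid Q l)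
    (h3 : Incid P m) (h4 : Incid Q m) : l = m := by
  have hinf : l.1 ⊓ m.1 = l.1 := by
    apply Submodule.eq_of_le_of_finrank_le inf_le_left
    rw [l.2]
    by_contra hlt
    have hle : Module.finrank F ↥(l.1 ⊓ m.1) ≤ 1 := by omega
    have hP : P.1 ≤ l.1 ⊓ m.1 := le_inf h1 h3
    have hQ : Q.1 ≤ l.1 ⊓ m.1 := le_inf h2 h4
    have e1 := Submodule.eq_of_le_of_finrank_le hP (by rw [P.2]; exact hle)
    have e2 := Submodule.eq_of_le_of_finrank_le hQ (by rw [Q.2]; exact hle)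
    exact hPQ (Subtype.ext (e1.trans e2.symm))
  exact Subtype.ext (Submodule.eq_of_le_of_finrank_eq (inf_eq_left.1 hinf) (l.2.trans m.2.symm))

theorem exists_other (P : Pt F) (l : Ln F) : ∃ Q : Pt F, Q ≠ P ∧ Incid Q l := by
  have h : ¬ l.1 ≤ P.1 := by
    intro h
    have := Submodule.finrank_mono h
    rw [l.2, P.2] at this
    omega
  obtain ⟨v, hv, hvP⟩ := SetLike.not_le_iff_exists.1 h
  have hv0 : v ≠ 0 := by rintro rfl; exact hvP (zero_mem _)
  refine ⟨⟨Submodule.span F {v}, finrank_span_singleton hv0⟩, ?_, ?_⟩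
  · intro e
    apply hvP
    rw [← e]
    exact Submodule.mem_span_singleton_self v
  · exact (Submodule.span_singleton_le_iff_mem _ _).2 hv

theorem exists_meet (l m : Ln F) : ∃ Q : Pt F, Incid Q l ∧ Incid Q m := by
  have h : l.1 ⊓ m.1 ≠ ⊥ := by
    intro h
    have h1 := Submodule.finrank_sup_add_finrank_inf_eq l.1 m.1
    have h2 := Submodule.finrank_le (l.1 ⊔ m.1)
    rw [h, l.2, m.2, finrank_bot] at h1
    simp at h2
    omega
  obtain ⟨v, hv, hv0⟩ := Submodule.exists_mem_ne_zero_of_ne_bot h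
  exact ⟨⟨Submodule.span F {v}, finrank_span_singleton hv0⟩,
    (Submodule.span_singleton_le_iff_mem _ _).2 hv.1,
    (Submodule.span_singleton_le_iff_mem _ _).2 hv.2⟩

theorem tangent_diff {B : Set (Pt F)} {P : Pt F} {m : Ln F} (h : ¬ Incid P m) :
    IsTangent (B \ {P}) m ↔ IsTangent B m := by
  unfold IsTangent
  have : ∀ Q : Pt F, (Q ∈ B \ {P} ∧ Incid Q m) ↔ (Q ∈ B ∧ Incid Q m) := by
    intro Q
    constructor
    · rintro ⟨h1, h2⟩; exact ⟨h1.1, h2⟩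
    · rintro ⟨h1, h2⟩
      refine ⟨⟨h1, ?_⟩, h2⟩
      rintro rfl
      exact h h2
  simp only [this]

/-- The map `B ↦ B \ {P}` sends the set of blocking semiovals of PG(2,q) containing `P`
whose unique tangent through `P` is `l` onto the set of minimal affine blocking sets of
AG(2,q) = PG(2,q) \ l with the Π-strong property with respect to `Π_P`. -/
theorem image_blockingSemiovals_eq_piStrong
    (F : Type) [Field F] [Fintype F] (l : Ln F) (P : Pt F) (hPl : Incid P l) :
    (fun B : Set (Pt F) => B \ {P}) ''
      {B : Set (Pt F) | IsBlocking B ∧ IsSemioval B ∧ P ∈ B ∧ IsTangent B l ∧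
        ∀ L : Ln F, Incid P L → IsTangent B L → L = l}
      = {B' : Set (Pt F) | IsMinimalAffBlocking l B' ∧ PiStrong l P B'} := by
  apply Set.Subset.antisymm
  · rintro _ ⟨B, ⟨hB, hS, hPB, hT, hU⟩, rfl⟩
    have key : ∀ Q ∈ B \ {P}, ∀ m : Ln F, Incid Q m → IsTangent B m → ¬ Incid P m := by
      intro Q hQ m hQm hm hPm
      exact hQ.2 (hm.unique ⟨hQ.1, hQm⟩ ⟨hPB, hPm⟩)
    refine ⟨⟨⟨?_, ?_⟩, ?_⟩, ?_, ?_⟩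
    · intro Q hQ hQl
      exact key Q hQ l hQl hT hPl
    · intro m hm
      by_cases hPm : Incid P m
      · by_contra hc
        apply hm
        apply hU m hPm
        refine ⟨P, ⟨hPB, hPm⟩, ?_⟩
        rintro Q ⟨hQ, hQm⟩
        by_contra hne
        exact hc ⟨Q, ⟨hQ, hne⟩, hQm⟩
      · obtain ⟨Q, hQ, hQm⟩ := hB.1 m
        refine ⟨Q, ⟨hQ, ?_⟩, hQm⟩
        rintro rfl
        exact hPm hQm
    · intro C hC hCb
      obtain ⟨Q, hQ, hQC⟩ := Set.exists_of_ssubset hC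
      obtain ⟨m, ⟨hQm, hm⟩, -⟩ := hS Q hQ.1
      have hPm := key Q hQ m hQm hm
      obtain ⟨R, hR, hRm⟩ := hCb.2 m (by rintro rfl; exact hPm hPl)
      have : R = Q := hm.unique ⟨(hC.1 hR).1, hRm⟩ ⟨hQ.1, hQm⟩
      exact hQC (this ▸ hR)
    · intro Q hQ
      obtain ⟨m, ⟨hQm, hm⟩, hu⟩ := hS Q hQ.1
      have hPm := key Q hQ m hQm hm
      refine ⟨m, ⟨by rintro rfl; exact hPm hPl, hPm, hQm, (tangent_diff hPm).2 hm⟩, ?_⟩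
      rintro m' ⟨-, h2, h3, h4⟩
      exact hu m' ⟨h3, (tangent_diff h2).1 h4⟩
    · intro m hm hPm hsub
      obtain ⟨R, hRm, hRB⟩ := hB.2 m
      by_cases hRl : Incid R l
      · by_cases hRP : R = P
        · exact hRB (hRP ▸ hPB)
        · exact hm (ln_unique hRP hRm hPm hRl hPl)
      · exact hRB (hsub ⟨hRm, hRl⟩).1
  · rintro B' ⟨⟨⟨hA, hbl⟩, -⟩, hS, hJ⟩
    have hPB' : P ∉ B' := fun h => hA P h hPl
    have hdiff : insert P B' \ {P} = B' := by
      ext Q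
      constructor
      · rintro ⟨h1, h2⟩
        exact h1.resolve_left h2
      · intro h
        refine ⟨Or.inr h, ?_⟩
        rintro rfl
        exact hPB' h
    have htl : IsTangent (insert P B') l := by
      refine ⟨P, ⟨Or.inl rfl, hPl⟩, ?_⟩
      rintro Q ⟨hQ, hQl⟩
      exact hQ.resolve_right (fun h => hA Q h hQl)
    have hU : ∀ L : Ln F, Incid P L → IsTangent (insert P B') L → L = l := by
      intro L hPL hL
      by_contra hne
      obtain ⟨Q, hQ, hQL⟩ := hbl L hne
      have : Q = P := hL.unique ⟨Or.inr hQ, hQL⟩ ⟨Or.inl rfl, hPL⟩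
      exact hPB' (this ▸ hQ)
    refine ⟨insert P B', ⟨⟨?_, ?_⟩, ?_, Or.inl rfl, htl, hU⟩, hdiff⟩
    · intro L
      by_cases hL : L = l
      · exact ⟨P, Or.inl rfl, hL ▸ hPl⟩
      · obtain ⟨Q, hQ, hQL⟩ := hbl L hL
        exact ⟨Q, Or.inr hQ, hQL⟩
    · intro L
      by_cases hL : L = l
      · obtain ⟨Q, hQ, hQl⟩ := exists_other P l
        exact ⟨Q, hL ▸ hQl, fun h => h.elim hQ (fun h => hA Q h hQl)⟩
      by_cases hPL : Incid P L
      · obtain ⟨Q, ⟨hQL, hQl⟩, hQ⟩ := Set.not_subset.1 (hJ L hL hPL)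
        refine ⟨Q, hQL, fun h => h.elim ?_ hQ⟩
        rintro rfl
        exact hQl hPl
      · obtain ⟨Q, hQl, hQL⟩ := exists_meet l L
        refine ⟨Q, hQL, fun h => h.elim ?_ (fun h => hA Q h hQl)⟩
        rintro rfl
        exact hPL hQL
    · intro Q hQ
      rcases hQ with rfl | hQ
      · exact ⟨l, ⟨hPl, htl⟩, fun L h => hU L h.1 h.2⟩
      · obtain ⟨m, ⟨h1, h2, h3, h4⟩, hu⟩ := hS Q hQ
        refine ⟨m, ⟨h3, (tangent_diff h2).1 (by rw [hdiff]; exact h4)⟩, ?_⟩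
        rintro m' ⟨h5, h6⟩
        have hPm' : ¬ Incid P m' := by
          intro hPm'
          have : Q = P := h6.unique ⟨Or.inr hQ, h5⟩ ⟨Or.inl rfl, hPm'⟩
          exact hPB' (this ▸ hQ)
        have h7 := (tangent_diff hPm').2 h6
        rw [hdiff] at h7
        exact hu m' ⟨by rintro rfl; exact hPm' hPl, hPm', h5, h7⟩
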